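/- arXiv:1912.11596 — 2 statements merged into one kernel-verified Lean document; each statement's English description precedes it below -/
import Mathlib

section
/- Let Z be a semi-negative continuous linear operator on V with ‖Z‖ ≤ λ for some λ ≥ 0. Then for every integer l ≥ 1, every ε > 0, and every v ∈ V, | ⟨Z^{l−1}v, Z^{l+1}v⟩ + ‖Zˡ v‖² | ≤ ε [Z^{l−1}v]² + (λ/(2ε)) ‖Zˡ v‖². -/
open RealInnerProductSpace

/-- The semi-inner-product `[v, w] := −⟨Zv, w⟩ − ⟨v, Zw⟩` associated with `Z`. -/
noncomputable def semiIP {V : Type*} [NormedAddCommGroup V] [InnerProductSpace ℝ V]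
    (Z : V →L[ℝ] V) (v w : V) : ℝ :=
  -⟪Z v, w⟫ - ⟪v, Z w⟫

section SemiIP

variable {V : Type*} [NormedAddCommGroup V] [InnerProductSpace ℝ V] (Z : V →L[ℝ] V)

theorem semiIP_self (v : V) : semiIP Z v v = -2 * ⟪Z v, v⟫ := by
  rw [semiIP, real_inner_comm (Z v) v]
  ring

theorem semiIP_smul_add_self (c : ℝ) (v w : V) :
    semiIP Z (c • v + w) (c • v + w) =
      c ^ 2 * semiIP Z v v + 2 * c * semiIP Z v w + semiIP Z w w := by
  simp only [semiIP, map_add, map_smul, inner_add_left, inner_add_right,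
    real_inner_smul_left, real_inner_smul_right, real_inner_comm (Z _)]
  ring

theorem semiIP_self_le {lam : ℝ} (h : ‖Z‖ ≤ lam) (v : V) :
    semiIP Z v v ≤ 2 * lam * ‖v‖ ^ 2 := by
  have h₁ : |⟪Z v, v⟫| ≤ ‖Z v‖ * ‖v‖ := abs_real_inner_le_norm _ _
  have h₂ : ‖Z v‖ * ‖v‖ ≤ lam * ‖v‖ * ‖v‖ := by
    gcongr
    exact Z.le_of_opNorm_le h v
  rw [semiIP_self]
  nlinarith [neg_abs_le ⟪Z v, v⟫]

variable {Z}

/-- Cauchy–Schwarz combined with Young's inequality for the semi-inner-product. -/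
theorem abs_semiIP_le (hZ : ∀ v : V, ⟪Z v, v⟫ ≤ 0) {ε : ℝ} (hε : 0 < ε) (v w : V) :
    |semiIP Z v w| ≤ ε * semiIP Z v v + semiIP Z w w / (4 * ε) := by
  have hnonneg (u : V) : 0 ≤ semiIP Z u u := by
    rw [semiIP_self]
    linarith [hZ u]
  have h₁ := hnonneg ((2 * ε) • v + w)
  have h₂ := hnonneg ((-(2 * ε)) • v + w)
  rw [semiIP_smul_add_self] at h₁ h₂
  have h : |semiIP Z v w| * (4 * ε) ≤ 4 * ε ^ 2 * semiIP Z v v + semiIP Z w w := by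
    rcases abs_cases (semiIP Z v w) with ⟨h, -⟩ | ⟨h, -⟩ <;> rw [h] <;> linarith
  calc |semiIP Z v w| ≤ (4 * ε ^ 2 * semiIP Z v v + semiIP Z w w) / (4 * ε) :=
        (le_div_iff₀ (by positivity)).2 h
    _ = ε * semiIP Z v v + semiIP Z w w / (4 * ε) := by field_simp

end SemiIP

/-- For a semi-negative operator `Z` with `‖Z‖ ≤ λ`, every `l ≥ 1`, `ε > 0`
and `v ∈ V`: `| ⟨Z^(l−1)v, Z^(l+1)v⟩ + ‖Zˡ v‖² | ≤ ε [Z^(l−1)v]² + (λ/(2ε)) ‖Zˡ v‖²`. -/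
theorem inner_pow_sub_add_norm_sq_le
    {V : Type*} [NormedAddCommGroup V] [InnerProductSpace ℝ V] [CompleteSpace V]
    (Z : V →L[ℝ] V) (hZ : ∀ v : V, ⟪Z v, v⟫ ≤ 0)
    (lam : ℝ) (hlam : 0 ≤ lam) (hZle : ‖Z‖ ≤ lam)
    (l : ℕ) (hl : 1 ≤ l) (ε : ℝ) (hε : 0 < ε) (v : V) :
    |⟪(Z ^ (l - 1)) v, (Z ^ (l + 1)) v⟫ + ‖(Z ^ l) v‖ ^ 2|
      ≤ ε * semiIP Z ((Z ^ (l - 1)) v) ((Z ^ (l - 1)) v)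
        + (lam / (2 * ε)) * ‖(Z ^ l) v‖ ^ 2 := by
  obtain ⟨k, rfl⟩ := Nat.exists_eq_add_of_le' hl
  rw [Nat.add_sub_cancel]
  set w := (Z ^ k) v
  have h₁ : (Z ^ (k + 1)) v = Z w := by rw [pow_succ']; rfl
  have h₂ : (Z ^ (k + 1 + 1)) v = Z (Z w) := by rw [pow_succ', pow_succ']; rfl
  rw [h₁, h₂]
  have h₃ : ⟪w, Z (Z w)⟫ + ‖Z w‖ ^ 2 = -semiIP Z w (Z w) := by
    rw [semiIP, real_inner_self_eq_norm_sq]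
    ring
  rw [h₃, abs_neg]
  calc |semiIP Z w (Z w)| ≤ ε * semiIP Z w w + semiIP Z (Z w) (Z w) / (4 * ε) :=
        abs_semiIP_le hZ hε _ _
    _ ≤ ε * semiIP Z w w + 2 * lam * ‖Z w‖ ^ 2 / (4 * ε) := by
        gcongr
        exact semiIP_self_le Z hZle _
    _ = ε * semiIP Z w w + lam / (2 * ε) * ‖Z w‖ ^ 2 := by
        field_simp
        ring
end

section
/- Let Z be a semi-negative continuous linear operator on V with ‖Z‖ ≤ λ for some λ ≥ 0, and let W : V → V be any continuous linear operator. Then for every integer l ≥ 1, every ε > 0, and every v ∈ V, ⟨Z^{l−1}v, Z(W(Z^{l+1}v))⟩ ≤ λ‖W‖(1 + λ²‖W‖/(2ε)) ‖Zˡ v‖² + ε [Z^{l−1}v]². -/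
open RealInnerProductSpace

theorem semiIP_self_le_s5 {V : Type*} [NormedAddCommGroup V] [InnerProductSpace ℝ V]
    (Z : V →L[ℝ] V) (x : V) : semiIP Z x x ≤ 2 * ‖Z‖ * ‖x‖ ^ 2 := by
  have h₁ : -⟪Z x, x⟫ ≤ ‖Z x‖ * ‖x‖ :=
    (neg_le_abs _).trans (abs_real_inner_le_norm _ _)
  have h₂ : ‖Z x‖ * ‖x‖ ≤ ‖Z‖ * ‖x‖ * ‖x‖ := by
    gcongr
    exact Z.le_opNorm x
  unfold semiIP
  rw [real_inner_comm (Z x) x]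
  nlinarith

/-- Young's inequality for the semi-inner-product of a semi-negative operator. -/
theorem neg_semiIP_le {V : Type*} [NormedAddCommGroup V] [InnerProductSpace ℝ V]
    (Z : V →L[ℝ] V) (hZ : ∀ v : V, ⟪Z v, v⟫ ≤ 0) {ε : ℝ} (hε : 0 < ε) (u x : V) :
    -semiIP Z u x ≤ ε * semiIP Z u u + semiIP Z x x / (4 * ε) := by
  have h := hZ ((2 * ε) • u + x)
  simp only [map_add, map_smul, inner_add_left, inner_add_right, real_inner_smul_left,
    real_inner_smul_right] at h
  have key : -semiIP Z u x - ε * semiIP Z u u ≤ semiIP Z x x / (4 * ε) := by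
    rw [le_div_iff₀ (by positivity)]
    unfold semiIP
    rw [real_inner_comm (Z u) u, real_inner_comm (Z x) x, real_inner_comm (Z x) u] at *
    nlinarith
  linarith

/-- For a semi-negative operator `Z` with `‖Z‖ ≤ λ` and any continuous linear
operator `W`, every `l ≥ 1`, `ε > 0` and `v ∈ V`:
`⟨Z^(l−1)v, Z(W(Z^(l+1)v))⟩ ≤ λ‖W‖(1 + λ²‖W‖/(2ε)) ‖Zˡ v‖² + ε [Z^(l−1)v]²`. -/
theorem inner_pow_Z_W_le
    {V : Type*} [NormedAddCommGroup V] [InnerProductSpace ℝ V] [CompleteSpace V]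
    (Z : V →L[ℝ] V) (hZ : ∀ v : V, ⟪Z v, v⟫ ≤ 0)
    (lam : ℝ) (hlam : 0 ≤ lam) (hZle : ‖Z‖ ≤ lam)
    (W : V →L[ℝ] V)
    (l : ℕ) (hl : 1 ≤ l) (ε : ℝ) (hε : 0 < ε) (v : V) :
    ⟪(Z ^ (l - 1)) v, Z (W ((Z ^ (l + 1)) v))⟫
      ≤ lam * ‖W‖ * (1 + lam ^ 2 * ‖W‖ / (2 * ε)) * ‖(Z ^ l) v‖ ^ 2
        + ε * semiIP Z ((Z ^ (l - 1)) v) ((Z ^ (l - 1)) v) := by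
  obtain ⟨k, rfl⟩ := Nat.exists_eq_add_of_le' hl
  simp only [Nat.add_sub_cancel, pow_succ' Z, mul_apply_eq_comp]
  set u := (Z ^ k) v
  set x := W (Z (Z u))
  have hx : ‖x‖ ≤ ‖W‖ * (lam * ‖Z u‖) :=
    W.le_opNorm_of_le (Z.le_of_opNorm_le hZle _)
  have hyx : -⟪Z u, x⟫ ≤ ‖Z u‖ * (‖W‖ * (lam * ‖Z u‖)) :=
    ((neg_le_abs _).trans (abs_real_inner_le_norm _ _)).trans (by gcongr)
  have hxx : semiIP Z x x ≤ 2 * lam * (‖W‖ * (lam * ‖Z u‖)) ^ 2 :=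
    (semiIP_self_le_s5 Z x).trans (by gcongr)
  calc ⟪u, Z x⟫ = -⟪Z u, x⟫ + -semiIP Z u x := by unfold semiIP; ring
    _ ≤ ‖Z u‖ * (‖W‖ * (lam * ‖Z u‖)) + (ε * semiIP Z u u
          + 2 * lam * (‖W‖ * (lam * ‖Z u‖)) ^ 2 / (4 * ε)) := by
        refine add_le_add hyx ((neg_semiIP_le Z hZ hε u x).trans ?_)
        gcongr
    _ = _ := by field_simp; ring
end
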